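/- Let F be a distribution function on [0,1] with F(s) = A s^β L(1/s) near 0, where A > 0, β > 0, and L is slowly varying. Then ∫₀¹ (1−s)^k dF(s) ~ A Γ(β+1) k^{−β} L(k) as k → ∞. -/

import Mathlib

open MeasureTheory Set Filter

/-- Polynomial growth from doubling. -/
theorem kpt_growth (F : ℝ → ℝ) (hmono : Monotone F) (m : ℕ)
    (hnn : ∀ s, 0 ≤ F s)
    (hd : ∀ s > 0, F (2 * s) ≤ 2 ^ m * F s) (s t : ℝ) (hs : 0 < s) (ht : 0 < t) :
    F (t * s) ≤ (2 * (t + 1)) ^ m * F s := by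
  have hpow : ∀ n : ℕ, F (2 ^ n * s) ≤ ((2:ℝ) ^ n) ^ m * F s := by
    intro n
    induction n with
    | zero => simp
    | succ n ih =>
      have h1 := hd (2 ^ n * s) (by positivity)
      calc F (2 ^ (n + 1) * s) = F (2 * (2 ^ n * s)) := by congr 1; ring
        _ ≤ 2 ^ m * F (2 ^ n * s) := h1
        _ ≤ 2 ^ m * (((2:ℝ) ^ n) ^ m * F s) := by gcongr
        _ = ((2:ℝ) ^ (n + 1)) ^ m * F s := by rw [pow_succ (2:ℝ) n, mul_pow]; ring
  obtain ⟨n, hn1, hn2⟩ := exists_nat_pow_near (x := t + 1) (y := (2:ℝ)) (by linarith) (by norm_num)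
  calc F (t * s) ≤ F (2 ^ (n + 1) * s) := hmono (by gcongr; linarith)
    _ ≤ ((2:ℝ) ^ (n + 1)) ^ m * F s := hpow _
    _ ≤ (2 * (t + 1)) ^ m * F s := by
      have := hnn s
      gcongr
      rw [pow_succ]; linarith

/-- Doubling from regular variation. -/
theorem kpt_doubling (F : ℝ → ℝ) (hmono : Monotone F) (hle : ∀ s, F s ≤ 1)
    (hpos : ∀ s > 0, 0 < F s) (c : ℝ)
    (hlim : Tendsto (fun s => F (2 * s) / F s) (nhdsWithin 0 (Ioi 0)) (nhds c)) :
    ∃ m : ℕ, ∀ s > 0, F (2 * s) ≤ 2 ^ m * F s := by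
  have h1 : ∀ᶠ s in nhdsWithin (0:ℝ) (Ioi 0), F (2 * s) / F s < c + 1 :=
    hlim.eventually_lt_const (by linarith)
  obtain ⟨s0, hs0, h2⟩ := (mem_nhdsGT_iff_exists_Ioc_subset).1 h1
  have hs0 : 0 < s0 := hs0
  obtain ⟨m, hm⟩ := pow_unbounded_of_one_lt (max (c + 1) (1 / F s0)) (one_lt_two : (1:ℝ) < 2)
  refine ⟨m, fun s hs => ?_⟩
  have hFs := hpos s hs
  rcases le_or_gt s s0 with h | h
  · have h3 : F (2 * s) / F s < c + 1 := h2 ⟨hs, h⟩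
    rw [div_lt_iff₀ hFs] at h3
    have : c + 1 ≤ 2 ^ m := (le_max_left _ _).trans hm.le
    nlinarith
  · have h3 : 1 / F s0 ≤ 2 ^ m := (le_max_right _ _).trans hm.le
    have h4 := hpos s0 hs0
    rw [div_le_iff₀ h4] at h3
    have h5 : F s0 ≤ F s := hmono h.le
    calc F (2 * s) ≤ 1 := hle _
      _ ≤ 2 ^ m * F s0 := h3
      _ ≤ 2 ^ m * F s := by gcongr

theorem kpt_exp_lim (t : ℝ) :
    Tendsto (fun k : ℕ => (1 - t / (k:ℝ)) ^ (k - 1)) atTop (nhds (Real.exp (-t))) := by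
  have h1 := Real.tendsto_one_add_div_pow_exp (-t)
  have h2 : Tendsto (fun k : ℕ => 1 - t / (k:ℝ)) atTop (nhds 1) := by
    simpa using (tendsto_const_div_atTop_nhds_zero_nat t).const_sub 1
  have h3 := h1.div h2 one_ne_zero
  rw [div_one] at h3
  refine h3.congr' ?_
  filter_upwards [h2.eventually_ne one_ne_zero, eventually_ge_atTop 1] with k hk hk1
  obtain ⟨j, rfl⟩ := Nat.exists_eq_add_of_le' hk1
  simp only [Nat.add_sub_cancel, Pi.div_apply]
  rw [div_eq_iff hk, ← pow_succ]
  congr 1; ring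

theorem kpt_bound (m k : ℕ) (hk : 2 ≤ k) (t : ℝ) (ht : 0 < t) (htk : t ≤ k) :
    (1 - t / (k:ℝ)) ^ (k - 1) * (2 * (t + 1)) ^ m
      ≤ (8 ^ m * (m.factorial : ℝ) * Real.exp (1/4)) * Real.exp (-(1/4) * t) := by
  have hk0 : (2:ℝ) ≤ k := by exact_mod_cast hk
  have hb0 : 0 ≤ 1 - t / (k:ℝ) := by
    rw [sub_nonneg, div_le_one (by linarith)]; exact htk
  have h1 : (1 - t / (k:ℝ)) ^ (k - 1) ≤ Real.exp (-(t/2)) := by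
    calc (1 - t / (k:ℝ)) ^ (k - 1) ≤ (Real.exp (-(t / k))) ^ (k - 1) := by
          gcongr
          exact Real.one_sub_le_exp_neg _
      _ = Real.exp (((k - 1 : ℕ) : ℝ) * (-(t / k))) := by rw [Real.exp_nat_mul]
      _ ≤ Real.exp (-(t/2)) := by
          apply Real.exp_le_exp.2
          rw [Nat.cast_sub (by omega)]
          have : (k:ℝ) * (t / k) = t := by field_simp
          have h4 : t / k ≤ t / 2 := by gcongr
          push_cast
          nlinarith
  have h2 : (2 * (t + 1)) ^ m ≤ 8 ^ m * (m.factorial : ℝ) * Real.exp ((t+1)/4) := by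
    have h := Real.pow_div_factorial_le_exp ((t+1)/4) (by linarith) m
    rw [div_le_iff₀ (by positivity)] at h
    calc (2 * (t + 1)) ^ m = 8 ^ m * ((t+1)/4) ^ m := by rw [← mul_pow]; congr 1; ring
      _ ≤ 8 ^ m * (Real.exp ((t+1)/4) * (m.factorial : ℝ)) := by gcongr
      _ = _ := by ring
  calc (1 - t / (k:ℝ)) ^ (k - 1) * (2 * (t + 1)) ^ m
      ≤ Real.exp (-(t/2)) * (8 ^ m * (m.factorial : ℝ) * Real.exp ((t+1)/4)) := by gcongr
    _ = 8 ^ m * (m.factorial : ℝ) * (Real.exp (-(t/2)) * Real.exp ((t+1)/4)) := by ring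
    _ = 8 ^ m * (m.factorial : ℝ) * (Real.exp (1/4) * Real.exp (-(1/4) * t)) := by
        rw [← Real.exp_add, ← Real.exp_add]; congr 2; ring
    _ = _ := by ring

/-- The dominated convergence part. -/
theorem kpt_dct (F : ℝ → ℝ) (hmono : Monotone F) (hle : ∀ s, F s ≤ 1)
    (hnn : ∀ s, 0 ≤ F s)
    (hpos : ∀ s > 0, 0 < F s) (β : ℝ) (hβ : 0 < β)
    (hlim : ∀ t > 0, Tendsto (fun s => F (t * s) / F s) (nhdsWithin 0 (Ioi 0)) (nhds (t ^ β))) :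
    Tendsto (fun k : ℕ => ∫ t in Ioi (0:ℝ),
      (Iic (k:ℝ)).indicator (fun t => (1 - t / (k:ℝ)) ^ (k - 1) * (F (t / k) / F (1 / k))) t)
      atTop (nhds (Real.Gamma (β + 1))) := by
  obtain ⟨m, hm⟩ := kpt_doubling F hmono hle hpos _ (hlim 2 two_pos)
  have hF := kpt_growth F hmono m hnn hm
  rw [Real.Gamma_eq_integral (by linarith)]
  have hinv : Tendsto (fun k : ℕ => 1 / (k:ℝ)) atTop (nhdsWithin 0 (Ioi 0)) := by
    rw [tendsto_nhdsWithin_iff]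
    refine ⟨tendsto_one_div_atTop_nhds_zero_nat, ?_⟩
    filter_upwards [eventually_ge_atTop 1] with k hk
    have : (0:ℝ) < k := by exact_mod_cast hk
    simp only [mem_Ioi]; positivity
  apply tendsto_integral_filter_of_dominated_convergence
    (fun t => (8 ^ m * (m.factorial : ℝ) * Real.exp (1/4)) * Real.exp (-(1/4) * t))
  · refine Eventually.of_forall fun k => Measurable.aestronglyMeasurable ?_
    apply Measurable.indicator _ measurableSet_Iic
    have := hmono.measurable
    fun_prop
  · filter_upwards [eventually_ge_atTop 2] with k hk
    rw [ae_restrict_iff' measurableSet_Ioi]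
    refine Eventually.of_forall fun t ht => ?_
    have ht : 0 < t := ht
    have hk0 : (2:ℝ) ≤ k := by exact_mod_cast hk
    by_cases htk : t ≤ k
    · rw [indicator_of_mem (by exact htk)]
      have hb0 : 0 ≤ 1 - t / (k:ℝ) := by
        rw [sub_nonneg, div_le_one (by linarith)]; exact htk
      have hp := hpos (1 / k) (by positivity)
      rw [Real.norm_of_nonneg (mul_nonneg (pow_nonneg hb0 _) (div_nonneg (hnn _) hp.le))]
      refine le_trans ?_ (kpt_bound m k hk t ht htk)
      gcongr
      rw [div_le_iff₀ hp]
      have := hF (1 / k) t (by positivity) ht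
      rwa [mul_one_div] at this
    · rw [indicator_of_notMem (by exact htk)]
      simp only [norm_zero]; positivity
  · exact (exp_neg_integrableOn_Ioi 0 (by norm_num : (0:ℝ) < 1/4)).const_mul _
  · rw [ae_restrict_iff' measurableSet_Ioi]
    refine Eventually.of_forall fun t ht => ?_
    have ht : 0 < t := ht
    have h1 := (kpt_exp_lim t).mul ((hlim t ht).comp hinv)
    rw [add_sub_cancel_right]
    refine h1.congr' ?_
    filter_upwards [eventually_ge_atTop (Nat.ceil t)] with k hk
    rw [indicator_of_mem (by exact Nat.ceil_le.1 hk)]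
    simp only [Function.comp, mul_one_div]

theorem kpt_repr {Ω : Type*} [MeasurableSpace Ω] (μ : Measure Ω) [IsProbabilityMeasure μ]
    (S : Ω → ℝ) (hS_meas : Measurable S) (hS01 : ∀ ω, S ω ∈ Icc (0 : ℝ) 1) (k : ℕ) (hk : 1 ≤ k) :
    ∫ ω, (1 - S ω) ^ k ∂μ = ∫ t in Ioi (0:ℝ),
      (Iic (k:ℝ)).indicator (fun t => (1 - t / (k:ℝ)) ^ (k - 1) * μ.real {ω | S ω ≤ t / k}) t := by
  have hk0 : (0:ℝ) < k := by exact_mod_cast hk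
  have hpt : ∀ ω, (1 - S ω) ^ k = ∫ t in Ioc (0:ℝ) k,
      (if S ω ≤ t / k then (1 - t / (k:ℝ)) ^ (k - 1) else 0) := by
    intro ω
    obtain ⟨h0, h1⟩ := hS01 ω
    have hsk : k * S ω ≤ k := by nlinarith
    have e1 : ∫ t in Ioc (0:ℝ) k, (if S ω ≤ t / k then (1 - t / (k:ℝ)) ^ (k - 1) else 0)
        = ∫ t in Icc (k * S ω) k, (1 - t / (k:ℝ)) ^ (k - 1) := by
      rw [← integral_Icc_eq_integral_Ioc, ← integral_indicator measurableSet_Icc,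
        ← integral_indicator measurableSet_Icc]
      congr 1
      ext t
      have : S ω ≤ t / k ↔ k * S ω ≤ t := by rw [le_div_iff₀ hk0, mul_comm]
      simp only [indicator_apply, mem_Icc, this]
      have h00 : 0 ≤ k * S ω := by positivity
      split_ifs <;> first | rfl | (exfalso; grind)
    rw [e1, integral_Icc_eq_integral_Ioc, ← intervalIntegral.integral_of_le hsk]
    have hder : ∀ t ∈ uIcc (k * S ω) (k:ℝ),
        HasDerivAt (fun t => -(1 - t / (k:ℝ)) ^ k) ((1 - t / (k:ℝ)) ^ (k - 1)) t := by
      intro t _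
      have := ((((hasDerivAt_id t).div_const (k:ℝ)).const_sub 1).pow k).neg
      refine this.congr_deriv ?_
      simp only [id]
      field_simp
    rw [intervalIntegral.integral_eq_sub_of_hasDerivAt hder
      (Continuous.intervalIntegrable (by fun_prop) _ _)]
    rw [div_self hk0.ne', mul_div_cancel_left₀ _ hk0.ne', sub_self, zero_pow (by omega)]
    ring
  simp_rw [hpt]
  have hmeas : Measurable (fun p : Ω × ℝ =>
      (if S p.1 ≤ p.2 / k then (1 - p.2 / (k:ℝ)) ^ (k - 1) else 0)) := by
    apply Measurable.ite
    · exact measurableSet_le (by fun_prop) (by fun_prop)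
    · fun_prop
    · fun_prop
  have hint : Integrable (Function.uncurry fun (ω : Ω) (t : ℝ) =>
      (if S ω ≤ t / k then (1 - t / (k:ℝ)) ^ (k - 1) else 0))
      (μ.prod (volume.restrict (Ioc (0:ℝ) k))) := by
    refine Integrable.of_bound hmeas.aestronglyMeasurable 1 ?_
    have hae : ∀ᵐ p ∂(μ.prod (volume.restrict (Ioc (0:ℝ) k))), p.2 ∈ Ioc (0:ℝ) k :=
      Measure.quasiMeasurePreserving_snd.ae (ae_restrict_mem measurableSet_Ioc)
    filter_upwards [hae] with p hp
    simp only [Function.uncurry]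
    have a1 : 0 ≤ p.2 / k := div_nonneg hp.1.le hk0.le
    have a2 : p.2 / k ≤ 1 := (div_le_one hk0).2 hp.2
    split_ifs
    · rw [Real.norm_of_nonneg (pow_nonneg (by linarith) _)]
      exact pow_le_one₀ (by linarith) (by linarith)
    · simp
  rw [integral_integral_swap hint, setIntegral_indicator measurableSet_Iic, Ioi_inter_Iic]
  congr 1
  ext t
  have hms : MeasurableSet {ω | S ω ≤ t / k} := measurableSet_le hS_meas measurable_const
  have : (fun ω => if S ω ≤ t / k then (1 - t / (k:ℝ)) ^ (k - 1) else 0)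
      = {ω | S ω ≤ t / k}.indicator (fun _ => (1 - t / (k:ℝ)) ^ (k - 1)) := by
    ext ω; simp [indicator_apply]
  rw [this, integral_indicator_const _ hms, smul_eq_mul, mul_comm]

/-- Karamata/Tauberian transfer: if the single-trial success probability S ∈ [0,1] has
CDF F(s) = A s^β L(1/s) near 0 with A > 0, β > 0 and L slowly varying, then the pass@k
failure E[(1−S)^k] ~ A Γ(β+1) k^(−β) L(k) as k → ∞. -/
theorem karamata_passk_transfer
    {Ω : Type*} [MeasurableSpace Ω] (μ : Measure Ω) [IsProbabilityMeasure μ]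
    (S : Ω → ℝ) (hS_meas : Measurable S) (hS01 : ∀ ω, S ω ∈ Icc (0 : ℝ) 1)
    (A β : ℝ) (hA : 0 < A) (hβ : 0 < β)
    (L : ℝ → ℝ) (hL_pos : ∀ x > 0, 0 < L x)
    (hL_slow : ∀ l > 0, Tendsto (fun x : ℝ => L (l * x) / L x) atTop (nhds 1))
    (hF : ∃ ε > 0, ∀ s ∈ Ioc (0 : ℝ) ε,
      (μ {ω | S ω ≤ s}).toReal = A * s ^ β * L (1 / s)) :
    Tendsto
      (fun k : ℕ =>
        (∫ ω, (1 - S ω) ^ k ∂μ) /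
          (A * Real.Gamma (β + 1) * (k : ℝ) ^ (-β) * L k))
      atTop (nhds 1) := by
  obtain ⟨ε, hε, hF⟩ := hF
  set F : ℝ → ℝ := fun s => μ.real {ω | S ω ≤ s} with hFdef
  have hFe : ∀ s ∈ Ioc (0:ℝ) ε, F s = A * s ^ β * L (1 / s) := hF
  have hmono : Monotone F := fun a b hab =>
    measureReal_mono (fun ω (h : S ω ≤ a) => h.trans hab)
  have hle : ∀ s, F s ≤ 1 := fun s => measureReal_le_one
  have hnn : ∀ s, 0 ≤ F s := fun s => measureReal_nonneg
  have hpos : ∀ s > 0, 0 < F s := by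
    intro s hs
    have h1 : 0 < min s ε := lt_min hs hε
    have h2 : 0 < F (min s ε) := by
      rw [hFe _ ⟨h1, min_le_right _ _⟩]
      have := hL_pos (1 / min s ε) (by positivity)
      positivity
    exact h2.trans_le (hmono (min_le_left _ _))
  have hlim : ∀ t > 0, Tendsto (fun s => F (t * s) / F s) (nhdsWithin 0 (Ioi 0))
      (nhds (t ^ β)) := by
    intro t ht
    have h1 := ((hL_slow t⁻¹ (by positivity)).comp tendsto_inv_nhdsGT_zero).const_mul (t ^ β)
    rw [mul_one] at h1
    refine h1.congr' ?_
    have hd : 0 < min ε (ε / t) := lt_min hε (by positivity)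
    filter_upwards [Ioc_mem_nhdsGT hd] with s hs
    have hs0 := hs.1
    have hs1 : s ≤ ε := hs.2.trans (min_le_left _ _)
    have hs2 : t * s ≤ ε := by
      have := hs.2.trans (min_le_right _ _)
      rwa [le_div_iff₀ ht, mul_comm] at this
    rw [hFe s ⟨hs0, hs1⟩, hFe (t * s) ⟨by positivity, hs2⟩, Real.mul_rpow ht.le hs0.le]
    simp only [Function.comp, one_div, mul_inv]
    have := hL_pos s⁻¹ (by positivity)
    have h3 : 0 < s ^ β := by positivity
    field_simp
  have hG : Real.Gamma (β + 1) ≠ 0 := (Real.Gamma_pos_of_pos (by linarith)).ne'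
  have key := (kpt_dct F hmono hle hnn hpos β hβ hlim).div_const (Real.Gamma (β + 1))
  rw [div_self hG] at key
  refine key.congr' ?_
  filter_upwards [eventually_ge_atTop 1, eventually_ge_atTop (Nat.ceil (1 / ε))] with k hk hk2
  have hk0 : (0:ℝ) < k := by exact_mod_cast hk
  have hk3 : 1 / (k:ℝ) ≤ ε := by
    have := Nat.ceil_le.1 hk2
    rw [div_le_iff₀ hε] at this
    rw [div_le_iff₀ hk0]; linarith
  have hF1 : F (1 / k) = A * (k:ℝ) ^ (-β) * L k := by
    rw [hFe _ ⟨by positivity, hk3⟩, one_div_one_div, one_div, Real.inv_rpow hk0.le,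
      Real.rpow_neg hk0.le]
  rw [kpt_repr μ S hS_meas hS01 k hk]
  have e : (A * Real.Gamma (β + 1) * (k : ℝ) ^ (-β) * L k) = F (1 / k) * Real.Gamma (β + 1) := by
    rw [hF1]; ring
  rw [e, ← div_div]
  refine congrArg (fun x : ℝ => x / Real.Gamma (β + 1)) ?_
  rw [← integral_div]
  refine integral_congr_ae (Eventually.of_forall fun t => ?_)
  simp only [indicator_apply, hFdef]
  split_ifs
  · ring
  · simp
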